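/- Let p be a prime number, let I be a finite index set, let n_v ≥ 1 (v ∈ I) be positive integers, let k_v (v ∈ I) be integers with 1 ≤ k_v ≤ p − 1, and let a ≥ 0 be a nonnegative integer. Suppose that Σ_{v∈I} p·n_v + a = 24 and that, in the rational numbers, Σ_{v∈I} n_v·k_v(p − k_v)/p ≥ 6. Then p = 2, a = 0, k_v = 1 for every v ∈ I, Σ_{v∈I} n_v = 12, and Σ_{v∈I} n_v·k_v(p − k_v)/p = 6. -/

import Mathlib

/-- AM-GM bound for the local height contribution of a fiber of type `I_{pn}`. -/
lemma local_contribution_le {p : ℚ} (hp : 0 < p) {n : ℚ} (hn : 0 ≤ n) (k : ℚ) :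
    n * (k * (p - k)) / p ≤ p * n / 4 := by
  rw [div_le_iff₀ hp]
  nlinarith [mul_nonneg hn (sq_nonneg (p - 2 * k))]

/-- The equality case of `local_contribution_le`. -/
lemma two_mul_eq_of_local_contribution_eq {p : ℚ} (hp : 0 < p) {n : ℚ} (hn : 0 < n) {k : ℚ}
    (h : n * (k * (p - k)) / p = p * n / 4) : 2 * k = p := by
  rw [div_eq_iff hp.ne'] at h
  have hsq : n * (p - 2 * k) ^ 2 = 0 := by linarith
  have h0 : p - 2 * k = 0 := by simpa [hn.ne'] using hsq
  linarith

/-- Let `p` be a prime, `I` a finite index set, `n_v ≥ 1` positive integers, `k_v` integers with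
`1 ≤ k_v ≤ p − 1`, and `a ≥ 0`. Suppose `Σ p·n_v + a = 24` and, in `ℚ`,
`Σ n_v·k_v(p − k_v)/p ≥ 6`. Then `p = 2`, `a = 0`, `k_v = 1` for all `v`, `Σ n_v = 12`, and
`Σ n_v·k_v(p − k_v)/p = 6`. -/
theorem stmt_12 (p : ℕ) (hp : p.Prime) (I : Type*) [Fintype I]
    (n : I → ℕ) (hn : ∀ v, 1 ≤ n v)
    (k : I → ℕ) (hk1 : ∀ v, 1 ≤ k v) (hk2 : ∀ v, k v ≤ p - 1)
    (a : ℕ) (hsum : ∑ v, p * n v + a = 24)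
    (hge : (6 : ℚ) ≤ ∑ v, (n v : ℚ) * ((k v : ℚ) * ((p : ℚ) - (k v : ℚ))) / (p : ℚ)) :
    p = 2 ∧ a = 0 ∧ (∀ v, k v = 1) ∧ (∑ v, n v = 12) ∧
      (∑ v, (n v : ℚ) * ((k v : ℚ) * ((p : ℚ) - (k v : ℚ))) / (p : ℚ)) = 6 := by
  have hp0 : (0 : ℚ) < p := by exact_mod_cast hp.pos
  have hle : ∀ v ∈ Finset.univ, (n v : ℚ) * ((k v : ℚ) * ((p : ℚ) - (k v : ℚ))) / (p : ℚ)
      ≤ (p : ℚ) * n v / 4 :=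
    fun v _ => local_contribution_le hp0 (Nat.cast_nonneg _) _
  have hsum_le := Finset.sum_le_sum hle
  have hsumQ : (∑ v, (p : ℚ) * n v) + a = 24 := by exact_mod_cast hsum
  have hquarter : ∑ v, (p : ℚ) * n v / 4 = (24 - a) / 4 := by
    rw [← Finset.sum_div]
    linarith
  have ha0 : (0 : ℚ) ≤ a := Nat.cast_nonneg a
  have haQ : (a : ℚ) = 0 := by linarith
  have ha : a = 0 := by exact_mod_cast haQ
  have hheight : (∑ v, (n v : ℚ) * ((k v : ℚ) * ((p : ℚ) - (k v : ℚ))) / (p : ℚ)) = 6 := by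
    linarith
  have heq := (Finset.sum_eq_sum_iff_of_le hle).1 (by linarith)
  have hk : ∀ v, 2 * k v = p := fun v => by
    have hnv : (0 : ℚ) < n v := by exact_mod_cast hn v
    exact_mod_cast two_mul_eq_of_local_contribution_eq hp0 hnv (heq v (Finset.mem_univ v))
  obtain ⟨w⟩ : Nonempty I := by
    by_contra hI
    rw [not_nonempty_iff] at hI
    simp at hheight
  have hp2 : p = 2 :=
    ((Nat.prime_dvd_prime_iff_eq Nat.prime_two hp).1 (Dvd.intro _ (hk w))).symm
  refine ⟨hp2, ha, fun v => ?_, ?_, hheight⟩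
  · have := hk v
    omega
  · rw [← Finset.mul_sum, hp2, ha] at hsum
    omega
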